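/- Let C be a smooth non-reflexive plane curve of degree 7 over F_9 (so every tangent line of C meets C at its point of tangency with multiplicity at least 3), and suppose that every F_9-line is tangent to C at some point over the algebraic closure. Then at least 76 of the 91 F_9-lines are special tangents, i.e., are tangent to C only at points that are not F_9-rational. -/

import Mathlib

open MvPolynomial

noncomputable section

/-- The projective plane over a field `K`, as the projectivization of `K^3`. -/
abbrev ProjPlane (K : Type*) [Field K] := Projectivization K (Fin 3 → K)

variable {F : Type*} [Field F]

/-- A geometric point (over the algebraic closure) lies on the plane curve defined by `f`. -/
def OnCurve (f : MvPolynomial (Fin 3) F) (P : ProjPlane (AlgebraicClosure F)) : Prop :=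
  aeval P.rep f = 0

/-- A geometric point lies on the `F`-rational line with coefficient vector `a`. -/
def OnLine (a : Fin 3 → F) (P : ProjPlane (AlgebraicClosure F)) : Prop :=
  ∑ i, algebraMap F (AlgebraicClosure F) (a i) * P.rep i = 0

/-- The plane curve defined by `f` is smooth: the gradient of `f` is nonzero at every
geometric point of the curve. -/
def SmoothCurve (f : MvPolynomial (Fin 3) F) : Prop :=
  ∀ P : ProjPlane (AlgebraicClosure F), OnCurve f P → ∃ i, aeval P.rep (pderiv i f) ≠ 0

/-- The `F`-line with coefficients `a` meets the curve defined by `f` transversely: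
the intersection consists of exactly `d` distinct geometric points. -/
def Transverse (f : MvPolynomial (Fin 3) F) (a : Fin 3 → F) (d : ℕ) : Prop :=
  {P : ProjPlane (AlgebraicClosure F) | OnCurve f P ∧ OnLine a P}.ncard = d

/-- The restriction of `f` to the line `t ↦ v + t • w`, as a univariate polynomial. -/
def LinePoly (f : MvPolynomial (Fin 3) F) (v w : Fin 3 → AlgebraicClosure F) :
    Polynomial (AlgebraicClosure F) :=
  aeval (fun i => Polynomial.C (v i) + Polynomial.X * Polynomial.C (w i)) f

/-- `P` is a flex point of the curve defined by `f`: the tangent line at `P` meets the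
curve at `P` with intersection multiplicity at least 3. The tangent line is parametrized
through `P.rep` and a direction `w` lying on the tangent line, independent from `P.rep`. -/
def IsFlex (f : MvPolynomial (Fin 3) F) (P : ProjPlane (AlgebraicClosure F)) : Prop :=
  OnCurve f P ∧ ∃ w : Fin 3 → AlgebraicClosure F,
    (¬ ∃ c : AlgebraicClosure F, w = c • P.rep) ∧
    (∑ i, aeval P.rep (pderiv i f) * w i = 0) ∧
    (Polynomial.X : Polynomial (AlgebraicClosure F)) ^ 3 ∣ LinePoly f P.rep w

/-- The `F`-line with coefficients `a` is the tangent line to the curve `f` at the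
geometric point `P`, i.e. `a` is proportional to the gradient of `f` at `P`. -/
def IsTangentAt (f : MvPolynomial (Fin 3) F) (a : Fin 3 → F)
    (P : ProjPlane (AlgebraicClosure F)) : Prop :=
  OnCurve f P ∧ ∃ c : AlgebraicClosure F, c ≠ 0 ∧
    ∀ i, algebraMap F (AlgebraicClosure F) (a i) = c * aeval P.rep (pderiv i f)

/-- The `q`-power Frobenius map on the projective plane. -/
def FrobPt {K : Type*} [Field K] (q : ℕ) (P : ProjPlane K) : ProjPlane K :=
  Projectivization.mk K (fun i => P.rep i ^ q) (by
    intro hc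
    rcases Nat.eq_zero_or_pos q with h0 | h0
    · have := congrFun hc 0
      simp [h0] at this
    · apply P.rep_nonzero
      funext i
      have := congrFun hc i
      simp only [Pi.zero_apply] at this ⊢
      exact pow_eq_zero_iff h0.ne' |>.mp this)

/-- A geometric point of the projective plane is `F`-rational. -/
def IsRationalPt (P : ProjPlane (AlgebraicClosure F)) : Prop :=
  ∃ v : Fin 3 → F, v ≠ 0 ∧ ∃ c : AlgebraicClosure F, c ≠ 0 ∧
    ∀ i, P.rep i = c * algebraMap F (AlgebraicClosure F) (v i)

/-- The curve defined by `f` is Frobenius non-classical over `F` (with `q = #F`):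
the image of every geometric point of the curve under the `q`-power Frobenius lies on
the tangent line at that point. -/
def FrobeniusNonClassical (f : MvPolynomial (Fin 3) F) (q : ℕ) : Prop :=
  ∀ P : ProjPlane (AlgebraicClosure F), OnCurve f P →
    ∑ i, aeval P.rep (pderiv i f) * P.rep i ^ q = 0


/-- A homogeneous polynomial of degree `n` scales by `c ^ n`. -/
lemma aeval_smul_of_isHomogeneous {A : Type*} [CommRing A] [Algebra F A]
    {g : MvPolynomial (Fin 3) F} {n : ℕ} (hg : g.IsHomogeneous n) (c : A) (x : Fin 3 → A) :
    aeval (c • x) g = c ^ n * aeval x g := by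
  rw [aeval_def, aeval_def, eval₂_eq', eval₂_eq', Finset.mul_sum]
  refine Finset.sum_congr rfl fun d hd => ?_
  have hdeg : ∑ i, d i = n := by
    rw [← hg (mem_support_iff.mp hd), Finsupp.weight_apply, Finsupp.sum_fintype _ _ (by simp)]
    simp
  simp only [Pi.smul_apply, smul_eq_mul, mul_pow, Finset.prod_mul_distrib,
    Finset.prod_pow_eq_pow_sum, hdeg, mul_left_comm]

lemma eval_linePoly (f : MvPolynomial (Fin 3) F) (v w : Fin 3 → AlgebraicClosure F)
    (t : AlgebraicClosure F) : (LinePoly f v w).eval t = aeval (v + t • w) f := by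
  rw [LinePoly, ← Polynomial.coe_aeval_eq_eval, ← AlgHom.coe_restrictScalars' F,
    ← AlgHom.comp_apply, comp_aeval]
  congr 2
  ext i
  simp
  ring

lemma linePoly_comp (f : MvPolynomial (Fin 3) F) (v w : Fin 3 → AlgebraicClosure F)
    (t : AlgebraicClosure F) :
    (LinePoly f v w).comp (Polynomial.X + Polynomial.C t) = LinePoly f (v + t • w) w := by
  refine Polynomial.funext fun s => ?_
  simp only [Polynomial.eval_comp, Polynomial.eval_add, Polynomial.eval_X, Polynomial.eval_C,
    eval_linePoly]
  congr 2
  module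

lemma linePoly_smul {f : MvPolynomial (Fin 3) F} {n : ℕ} (hf : f.IsHomogeneous n)
    (v w : Fin 3 → AlgebraicClosure F) (c : AlgebraicClosure F) :
    LinePoly f (c • v) (c • w) = Polynomial.C (c ^ n) * LinePoly f v w := by
  refine Polynomial.funext fun s => ?_
  simp only [Polynomial.eval_mul, Polynomial.eval_C, eval_linePoly,
    ← aeval_smul_of_isHomogeneous hf]
  congr 2
  module

lemma natDegree_linePoly_le {f : MvPolynomial (Fin 3) F} {n : ℕ} (hf : f.IsHomogeneous n)
    (v w : Fin 3 → AlgebraicClosure F) : (LinePoly f v w).natDegree ≤ n := by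
  have h := aeval_natDegree_le (m := n) (n := 1) (map (algebraMap F (AlgebraicClosure F)) f)
    (hf.map _).totalDegree_le
    (fun i => Polynomial.C (v i) + Polynomial.X * Polynomial.C (w i)) fun i => by compute_degree
  rwa [aeval_map_algebraMap, mul_one] at h

/-- The chain rule for the restriction of a polynomial to a line. -/
lemma derivative_linePoly (f : MvPolynomial (Fin 3) F) (v w : Fin 3 → AlgebraicClosure F) :
    Polynomial.derivative (LinePoly f v w) =
      ∑ i, LinePoly (pderiv i f) v w * Polynomial.C (w i) := by
  induction f using MvPolynomial.induction_on with
  | C r => simp [LinePoly, Polynomial.algebraMap_apply]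
  | add p q hp hq =>
    simp only [LinePoly, map_add, add_mul, Finset.sum_add_distrib] at hp hq ⊢
    rw [hp, hq]
  | mul_X p j hp =>
    simp only [LinePoly, map_mul, aeval_X, Derivation.leibniz, pderiv_X, smul_eq_mul, map_add,
      Polynomial.derivative_mul] at hp ⊢
    rw [hp]
    simp only [Pi.single_apply, add_mul, Finset.sum_add_distrib, Finset.sum_mul]
    refine (add_comm _ _).trans (congrArg₂ (· + ·) ?_ ?_)
    · simp [apply_ite]
    · rw [← Finset.sum_add_distrib]
      exact Finset.sum_congr rfl fun i _ => by ring

/-- A line spanned by `v` and `w`, where `w ≠ 0` is any prescribed vector on it. -/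
lemma exists_spanning_vector {K : Type*} [Field K] {a w : Fin 3 → K} (ha : a ≠ 0) (hw : w ≠ 0)
    (haw : ∑ i, a i * w i = 0) :
    ∃ v : Fin 3 → K, ∑ i, a i * v i = 0 ∧ (∀ t : K, v + t • w ≠ 0) ∧
      ∀ x : Fin 3 → K, ∑ i, a i * x i = 0 → ∃ α β : K, x = α • v + β • w := by
  let φ : (Fin 3 → K) →ₗ[K] K := Fintype.linearCombination K a
  have hφ : ∀ x, φ x = ∑ i, a i * x i := fun x => by
    simp [φ, Fintype.linearCombination_apply, mul_comm]
  have hsurj : Function.Surjective φ := by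
    refine LinearMap.surjective fun h => ha ?_
    ext i
    simpa [hφ, Pi.single_apply] using LinearMap.congr_fun h (Pi.single i 1)
  have hrank : Module.finrank K (LinearMap.ker φ) = 2 := by
    have h := LinearMap.finrank_range_add_finrank_ker φ
    rw [LinearMap.range_eq_top.mpr hsurj] at h
    simp only [finrank_top, Module.finrank_self, Module.finrank_fin_fun] at h
    lia
  let w' : LinearMap.ker φ := ⟨w, by simpa [hφ] using haw⟩
  obtain ⟨v, hv⟩ := exists_linearIndependent_pair_of_one_lt_finrank (R := K) (x := w')
    (by lia) (by simpa [w', Subtype.ext_iff] using hw)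
  refine ⟨v, (hφ v).symm.trans v.2, fun t h => ?_, fun x hx => ?_⟩
  · have h' : t • w' + (1 : K) • v = 0 := by
      ext1
      simpa [w', add_comm] using h
    simpa using (LinearIndependent.pair_iff.mp hv t 1 h').2
  · have htop := hv.span_eq_top_of_card_eq_finrank' (by simp [hrank])
    have hmem : (⟨x, by simpa [hφ] using hx⟩ : LinearMap.ker φ) ∈
        Submodule.span K (Set.range ![w', v]) := htop ▸ Submodule.mem_top
    rw [Matrix.range_cons, Matrix.range_cons, Matrix.range_empty, Set.union_empty,
      Set.singleton_union, Submodule.mem_span_pair] at hmem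
    obtain ⟨β, α, h⟩ := hmem
    exact ⟨α, β, by simpa [w', add_comm] using (congrArg Subtype.val h).symm⟩

lemma SmoothCurve.exists_aeval_pderiv_ne_zero {f : MvPolynomial (Fin 3) F} {n : ℕ}
    (hf : f.IsHomogeneous n) (hsmooth : SmoothCurve f) {x : Fin 3 → AlgebraicClosure F}
    (hx : x ≠ 0) (hfx : aeval x f = 0) : ∃ i, aeval x (pderiv i f) ≠ 0 := by
  obtain ⟨c, hc⟩ := Projectivization.exists_smul_eq_mk_rep (AlgebraicClosure F) x hx
  rw [Units.smul_def] at hc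
  obtain ⟨i, hi⟩ := hsmooth (Projectivization.mk _ x hx) (by
    rw [OnCurve, ← hc, aeval_smul_of_isHomogeneous hf, hfx, mul_zero])
  refine ⟨i, fun h => hi ?_⟩
  rw [← hc, aeval_smul_of_isHomogeneous hf.pderiv, h, mul_zero]

/-- A homogeneous polynomial of positive degree has a zero on every line over the algebraic
closure, here in characteristic other than two. -/
lemma exists_zero_on_line {g : MvPolynomial (Fin 3) F} {n : ℕ} (hn : 0 < n)
    (hg : g.IsHomogeneous n) (h2 : (2 : F) ≠ 0) (v w : Fin 3 → AlgebraicClosure F) :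
    aeval w g = 0 ∨ ∃ t : AlgebraicClosure F, aeval (v + t • w) g = 0 := by
  by_contra! h
  have key : ∀ v w : Fin 3 → AlgebraicClosure F, (∀ t : AlgebraicClosure F,
      aeval (v + t • w) g ≠ 0) → ∀ t : AlgebraicClosure F, aeval (v + t • w) g = aeval v g := by
    intro v w h t
    have hdeg : (LinePoly g v w).degree = 0 := by
      by_contra hd
      obtain ⟨s, hs⟩ := IsAlgClosed.exists_root _ hd
      exact h s (by rwa [← eval_linePoly])
    have h0 : v = v + (0 : AlgebraicClosure F) • w := by simp
    conv_rhs => rw [h0]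
    rw [← eval_linePoly, ← eval_linePoly, Polynomial.eq_C_of_degree_eq_zero hdeg]
    simp
  have hinv : ∀ s : AlgebraicClosure F, s ≠ 0 →
      aeval (w + s • v) g = s ^ n * aeval (v + s⁻¹ • w) g := by
    intro s hs
    rw [← aeval_smul_of_isHomogeneous hg]
    congr 2
    rw [smul_add, smul_smul, mul_inv_cancel₀ hs, one_smul, add_comm]
  have hw := key w v fun s => by
    rcases eq_or_ne s 0 with rfl | hs
    · simpa using h.1
    · rw [hinv s hs]
      exact mul_ne_zero (pow_ne_zero _ hs) (h.2 _)
  have hpow : ∀ s : AlgebraicClosure F, s ≠ 0 → aeval w g = s ^ n * aeval v g := fun s hs => by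
    rw [← hw s, hinv s hs, key v w h.2]
  have hv0 : aeval v g ≠ 0 := by simpa using h.2 0
  obtain ⟨s, hs⟩ := IsAlgClosed.exists_pow_nat_eq (-1 : AlgebraicClosure F) hn
  have hs0 : s ≠ 0 := by
    rintro rfl
    simp [hn.ne'] at hs
  have hzero : (2 : AlgebraicClosure F) = 0 := by
    have e1 := hpow 1 one_ne_zero
    have e2 := hpow s hs0
    rw [hs] at e2
    rw [one_pow] at e1
    refine (mul_eq_zero.mp (?_ : (2 : AlgebraicClosure F) * aeval v g = 0)).resolve_right hv0
    linear_combination e2 - e1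
  exact h2 ((algebraMap F (AlgebraicClosure F)).injective
    (by simpa only [map_ofNat, map_zero] using hzero))

/-- A smooth plane curve of degree at least two contains no line. -/
lemma SmoothCurve.exists_aeval_ne_zero {f : MvPolynomial (Fin 3) F} {n : ℕ} (hn : 1 < n)
    (hf : f.IsHomogeneous n) (hsmooth : SmoothCurve f) (h2 : (2 : F) ≠ 0)
    {a : Fin 3 → AlgebraicClosure F} (ha : a ≠ 0) :
    ∃ w : Fin 3 → AlgebraicClosure F, ∑ i, a i * w i = 0 ∧ aeval w f ≠ 0 := by
  by_contra! hline
  obtain ⟨j, hj⟩ := Function.ne_iff.mp ha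
  have hgrad : ∀ x : Fin 3 → AlgebraicClosure F, ∑ i, a i * x i = 0 → x ≠ 0 →
      aeval x (pderiv j f) ≠ 0 := by
    intro x hx hx0 hzero
    obtain ⟨i, hi⟩ := hsmooth.exists_aeval_pderiv_ne_zero hf hx0 (hline x hx)
    let y : Fin 3 → AlgebraicClosure F := Pi.single i (a j) - Pi.single j (a i)
    have hy : ∑ k, a k * y k = 0 := by
      simp [y, Pi.single_apply, mul_sub, Finset.sum_sub_distrib, mul_comm]
    have hpoly : LinePoly f x y = 0 := Polynomial.funext fun t => by
      rw [eval_linePoly, Polynomial.eval_zero]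
      refine hline _ ?_
      simp only [Pi.add_apply, Pi.smul_apply, smul_eq_mul, mul_add, Finset.sum_add_distrib, hx,
        mul_left_comm _ t, ← Finset.mul_sum, hy, mul_zero, add_zero]
    have hder := congrArg (Polynomial.eval 0) (derivative_linePoly f x y)
    simp [hpoly, Polynomial.eval_finsetSum, eval_linePoly, y, Pi.single_apply, mul_sub,
      Finset.sum_sub_distrib, hzero] at hder
    exact hder.elim hi hj
  obtain ⟨w, hw0, hw⟩ : ∃ w : Fin 3 → AlgebraicClosure F, w ≠ 0 ∧ ∑ i, a i * w i = 0 := by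
    obtain ⟨k, hk⟩ := exists_ne j
    refine ⟨Pi.single k (a j) - Pi.single j (a k), fun h => hj ?_, ?_⟩
    · simpa [hk] using congrFun h k
    · simp [Pi.single_apply, mul_sub, Finset.sum_sub_distrib, mul_comm]
  obtain ⟨v, hv, hvw, -⟩ := exists_spanning_vector ha hw0 hw
  rcases exists_zero_on_line (Nat.sub_pos_of_lt hn) (hf.pderiv (i := j)) h2 v w with h | ⟨t, h⟩
  · exact hgrad w hw hw0 h
  · refine hgrad _ ?_ (hvw t) h
    simp only [Pi.add_apply, Pi.smul_apply, smul_eq_mul, mul_add, Finset.sum_add_distrib, hv,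
      mul_left_comm _ t, ← Finset.mul_sum, hw, mul_zero, add_zero]

lemma algebraMap_comp_ne_zero {x : Fin 3 → F} (hx : x ≠ 0) :
    (fun i => algebraMap F (AlgebraicClosure F) (x i)) ≠ 0 := fun h =>
  hx (funext fun i => by simpa using congrFun h i)

/-- If tangents meet the curve with multiplicity at least three, then each tangency point on a
line takes up three of the `n` intersection points of that line with the curve. -/
lemma card_add_two_mul_card_le {f : MvPolynomial (Fin 3) F} {n : ℕ} (hn : 1 < n)
    (hf : f.IsHomogeneous n) (hsmooth : SmoothCurve f) (h2 : (2 : F) ≠ 0)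
    (hflex3 : ∀ P : ProjPlane (AlgebraicClosure F), OnCurve f P →
      ∀ w : Fin 3 → AlgebraicClosure F, (∑ i, aeval P.rep (pderiv i f) * w i = 0) →
        (Polynomial.X : Polynomial (AlgebraicClosure F)) ^ 3 ∣ LinePoly f P.rep w)
    {a : Fin 3 → F} (ha : a ≠ 0) {S T : Finset (ProjPlane (AlgebraicClosure F))} (hTS : T ⊆ S)
    (hS : ∀ P ∈ S, OnCurve f P ∧ OnLine a P) (hT : ∀ P ∈ T, IsTangentAt f a P) :
    S.card + 2 * T.card ≤ n := by
  classical
  have hb := algebraMap_comp_ne_zero ha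
  obtain ⟨w, hw, hfw⟩ := hsmooth.exists_aeval_ne_zero hn hf h2 hb
  have hw0 : w ≠ 0 := by
    rintro rfl
    refine hfw ?_
    have h := aeval_smul_of_isHomogeneous hf (0 : AlgebraicClosure F) 0
    rwa [smul_zero, zero_pow (by lia), zero_mul] at h
  obtain ⟨v, hv, -, hspan⟩ := exists_spanning_vector hb hw0 hw
  have hparam : ∀ P ∈ S, ∃ t α : AlgebraicClosure F, α ≠ 0 ∧ P.rep = α • (v + t • w) := by
    intro P hP
    obtain ⟨α, β, h⟩ := hspan P.rep (hS P hP).2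
    have hα : α ≠ 0 := by
      rintro rfl
      rw [zero_smul, zero_add] at h
      have hfP : aeval P.rep f = 0 := (hS P hP).1
      rw [h, aeval_smul_of_isHomogeneous hf] at hfP
      have hβ : β = 0 := pow_eq_zero_iff (by lia) |>.mp ((mul_eq_zero.mp hfP).resolve_right hfw)
      exact P.rep_nonzero (by rw [h, hβ, zero_smul])
    refine ⟨β / α, α, hα, ?_⟩
    rw [h, smul_add, smul_smul, mul_div_cancel₀ _ hα]
  choose! t α hα hrep using hparam
  have hp : LinePoly f v w ≠ 0 := by
    intro hp
    have hq : Polynomial.X * LinePoly f w v = 0 := Polynomial.funext fun s => by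
      rcases eq_or_ne s 0 with rfl | hs
      · simp
      · have h : w + s • v = s • (v + s⁻¹ • w) := by
          rw [smul_add, smul_smul, mul_inv_cancel₀ hs, one_smul, add_comm]
        rw [Polynomial.eval_mul, eval_linePoly, h, aeval_smul_of_isHomogeneous hf,
          ← eval_linePoly, hp]
        simp
    have h := eval_linePoly f w v 0
    rw [(mul_eq_zero.mp hq).resolve_left Polynomial.X_ne_zero] at h
    exact hfw (by simpa using h.symm)
  have hroot : ∀ P ∈ S, 1 ≤ (LinePoly f v w).rootMultiplicity (t P) := by
    intro P hP
    have hfP : aeval P.rep f = 0 := (hS P hP).1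
    rw [hrep P hP, aeval_smul_of_isHomogeneous hf] at hfP
    refine (Polynomial.rootMultiplicity_pos hp).mpr ?_
    rw [Polynomial.IsRoot, eval_linePoly]
    exact (mul_eq_zero.mp hfP).resolve_left (pow_ne_zero _ (hα P hP))
  have hroot3 : ∀ P ∈ T, 3 ≤ (LinePoly f v w).rootMultiplicity (t P) := by
    intro P hP
    obtain ⟨hfP, c, hc, hac⟩ := hT P hP
    have hflex := hflex3 P hfP (α P • w) (by
      refine (mul_eq_zero.mp (?_ : c * _ = 0)).resolve_left hc
      calc c * ∑ i, aeval P.rep (pderiv i f) * (α P • w) i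
          = α P * ∑ i, algebraMap F (AlgebraicClosure F) (a i) * w i := by
            simp only [Finset.mul_sum, hac, Pi.smul_apply, smul_eq_mul]
            exact Finset.sum_congr rfl fun i _ => by ring
        _ = 0 := by rw [hw, mul_zero])
    rw [hrep P (hTS hP), linePoly_smul hf, ← linePoly_comp] at hflex
    have hunit : IsUnit (Polynomial.C (α P ^ n)) :=
      Polynomial.isUnit_C.mpr (pow_ne_zero _ (hα P (hTS hP))).isUnit
    rw [hunit.dvd_mul_left] at hflex
    have hdvd := map_dvd (Polynomial.compRingHom (Polynomial.X - Polynomial.C (t P))) hflex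
    rw [Polynomial.le_rootMultiplicity_iff hp]
    simpa [Polynomial.comp_assoc] using hdvd
  have hinj : Set.InjOn t S := by
    intro P hP Q hQ hPQ
    rw [← P.mk_rep, ← Q.mk_rep, Projectivization.mk_eq_mk_iff']
    refine ⟨α P / α Q, ?_⟩
    rw [hrep P hP, hrep Q hQ, hPQ, smul_smul, div_mul_cancel₀ _ (hα Q hQ)]
  calc S.card + 2 * T.card = ∑ P ∈ S, (1 + if P ∈ T then 2 else 0) := by
        rw [Finset.sum_add_distrib, Finset.sum_ite_mem, Finset.inter_eq_right.mpr hTS]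
        simp [mul_comm]
    _ ≤ ∑ P ∈ S, (LinePoly f v w).roots.count (t P) := by
        refine Finset.sum_le_sum fun P hP => ?_
        rw [Polynomial.count_roots]
        split_ifs with h
        · exact hroot3 P h
        · exact hroot P hP
    _ = ∑ s ∈ S.image t, (LinePoly f v w).roots.count s := by rw [Finset.sum_image hinj]
    _ ≤ ∑ s ∈ (LinePoly f v w).roots.toFinset, (LinePoly f v w).roots.count s := by
        refine Finset.sum_le_sum_of_subset fun s hs => ?_
        obtain ⟨P, hP, rfl⟩ := Finset.mem_image.mp hs
        rw [Multiset.mem_toFinset, ← Multiset.count_pos, Polynomial.count_roots]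
        exact hroot P hP
    _ = (LinePoly f v w).roots.card := Multiset.toFinset_sum_count_eq _
    _ ≤ n := (Polynomial.card_roots' _).trans (natDegree_linePoly_le hf v w)

lemma Projectivization.mk_eq_mk_iff_mul_eq_mul {K ι : Type*} [Field K] {x y : ι → K}
    (hx : x ≠ 0) (hy : y ≠ 0) :
    Projectivization.mk K x hx = Projectivization.mk K y hy ↔
      ∀ i j, x i * y j = x j * y i := by
  rw [Projectivization.mk_eq_mk_iff']
  constructor
  · rintro ⟨c, rfl⟩ i j
    simp only [Pi.smul_apply, smul_eq_mul]
    ring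
  · intro h
    obtain ⟨j, hj⟩ := Function.ne_iff.mp hy
    rw [Pi.zero_apply] at hj
    refine ⟨x j / y j, funext fun i => ?_⟩
    rw [Pi.smul_apply, smul_eq_mul, div_mul_eq_mul_div, div_eq_iff hj, h i j]

/-- The geometric point underlying a point of the projective plane over `F`. -/
def geometricPoint (Q : ProjPlane F) : ProjPlane (AlgebraicClosure F) :=
  Projectivization.mk _ (fun i => algebraMap F (AlgebraicClosure F) (Q.rep i))
    (algebraMap_comp_ne_zero Q.rep_nonzero)

lemma geometricPoint_injective : Function.Injective (geometricPoint (F := F)) := by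
  intro Q R h
  rw [geometricPoint, geometricPoint, Projectivization.mk_eq_mk_iff_mul_eq_mul] at h
  rw [← Q.mk_rep, ← R.mk_rep, Projectivization.mk_eq_mk_iff_mul_eq_mul]
  intro i j
  exact (algebraMap F (AlgebraicClosure F)).injective (by simpa only [map_mul] using h i j)

lemma exists_rep_geometricPoint (Q : ProjPlane F) : ∃ c : AlgebraicClosure F, c ≠ 0 ∧
    ∀ i, (geometricPoint Q).rep i = c * algebraMap F (AlgebraicClosure F) (Q.rep i) := by
  obtain ⟨c, hc⟩ := Projectivization.exists_smul_eq_mk_rep (AlgebraicClosure F) _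
    (algebraMap_comp_ne_zero Q.rep_nonzero)
  exact ⟨c, c.ne_zero, fun i => (congrFun hc i).symm⟩

lemma isRationalPt_iff {P : ProjPlane (AlgebraicClosure F)} :
    IsRationalPt P ↔ ∃ Q, geometricPoint Q = P := by
  constructor
  · rintro ⟨v, hv, c, hc, h⟩
    refine ⟨Projectivization.mk F v hv, ?_⟩
    obtain ⟨u, hu⟩ := Projectivization.exists_smul_eq_mk_rep F v hv
    rw [← P.mk_rep, geometricPoint, Projectivization.mk_eq_mk_iff_mul_eq_mul]
    intro i j
    rw [h, h, ← hu]
    simp only [Units.smul_def, Pi.smul_apply, smul_eq_mul, map_mul]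
    ring
  · rintro ⟨Q, rfl⟩
    exact ⟨Q.rep, Q.rep_nonzero, exists_rep_geometricPoint Q⟩

lemma onLine_geometricPoint_iff (L Q : ProjPlane F) :
    OnLine L.rep (geometricPoint Q) ↔ Projectivization.orthogonal Q L := by
  obtain ⟨c, hc, h⟩ := exists_rep_geometricPoint Q
  conv_rhs => rw [← Q.mk_rep, ← L.mk_rep]
  rw [Projectivization.orthogonal_mk, dotProduct,
    ← map_eq_zero_iff _ (algebraMap F (AlgebraicClosure F)).injective, OnLine]
  have hsum : ∑ i, algebraMap F (AlgebraicClosure F) (L.rep i) * (geometricPoint Q).rep i =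
      c * algebraMap F (AlgebraicClosure F) (∑ i, Q.rep i * L.rep i) := by
    simp only [h, map_sum, map_mul, Finset.mul_sum]
    exact Finset.sum_congr rfl fun i _ => by ring
  rw [hsum, mul_eq_zero, or_iff_right hc]

/-- A point of tangency lies on the tangent line. -/
lemma IsTangentAt.onLine {f : MvPolynomial (Fin 3) F} {n : ℕ} (hf : f.IsHomogeneous n)
    {a : Fin 3 → F} {P : ProjPlane (AlgebraicClosure F)} (h : IsTangentAt f a P) :
    OnLine a P := by
  obtain ⟨hfP, c, -, hac⟩ := h
  have heuler := congrArg (aeval P.rep) hf.sum_X_mul_pderiv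
  have hfP' : aeval P.rep f = 0 := hfP
  simp only [map_sum, map_mul, aeval_X, map_nsmul, hfP', smul_zero] at heuler
  calc ∑ i, algebraMap F (AlgebraicClosure F) (a i) * P.rep i
      = c * ∑ i, P.rep i * aeval P.rep (pderiv i f) := by
        rw [Finset.mul_sum]
        exact Finset.sum_congr rfl fun i _ => by rw [hac]; ring
    _ = 0 := by rw [heuler, mul_zero]

/-- The tangent line at a point is unique. -/
lemma IsTangentAt.eq {f : MvPolynomial (Fin 3) F} {L M : ProjPlane F}
    {P : ProjPlane (AlgebraicClosure F)} (hL : IsTangentAt f L.rep P)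
    (hM : IsTangentAt f M.rep P) : L = M := by
  obtain ⟨-, c, -, hc⟩ := hL
  obtain ⟨-, d, -, hd⟩ := hM
  rw [← L.mk_rep, ← M.mk_rep, Projectivization.mk_eq_mk_iff_mul_eq_mul]
  intro i j
  refine (algebraMap F (AlgebraicClosure F)).injective ?_
  rw [map_mul, map_mul, hc, hc, hd, hd]
  ring

lemma IsTangentAt.frobPt [Fintype F] {f : MvPolynomial (Fin 3) F} {n : ℕ}
    (hf : f.IsHomogeneous n) {a : Fin 3 → F} {P : ProjPlane (AlgebraicClosure F)}
    (h : IsTangentAt f a P) : IsTangentAt f a (FrobPt (Fintype.card F) P) := by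
  obtain ⟨hfP, c, hc, hac⟩ := h
  have hfP' : aeval P.rep f = 0 := hfP
  let φ := FiniteField.frobeniusAlgHom F (AlgebraicClosure F)
  obtain ⟨u, hu⟩ : ∃ u : (AlgebraicClosure F)ˣ,
      (FrobPt (Fintype.card F) P).rep = (u : AlgebraicClosure F) • fun i => φ (P.rep i) := by
    obtain ⟨u, hu⟩ := Projectivization.exists_smul_eq_mk_rep (AlgebraicClosure F)
      (fun i => P.rep i ^ Fintype.card F) (fun h0 => P.rep_nonzero (funext fun i =>
        pow_eq_zero_iff Fintype.card_ne_zero |>.mp (congrFun h0 i)))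
    exact ⟨u, hu.symm⟩
  have hφ : ∀ g : MvPolynomial (Fin 3) F,
      aeval (fun i => φ (P.rep i)) g = φ (aeval P.rep g) := fun g => by
    rw [← AlgHom.comp_apply, comp_aeval]
  refine ⟨?_, φ c * (u : AlgebraicClosure F)⁻¹ ^ (n - 1), ?_, fun i => ?_⟩
  · rw [OnCurve, hu, aeval_smul_of_isHomogeneous hf, hφ, hfP', map_zero, mul_zero]
  · exact mul_ne_zero (by simpa using hc) (pow_ne_zero _ (inv_ne_zero u.ne_zero))
  · rw [hu, aeval_smul_of_isHomogeneous hf.pderiv, hφ, ← φ.commutes, hac, map_mul, mul_assoc,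
      ← mul_assoc (_ ^ _), ← mul_pow, inv_mul_cancel₀ u.ne_zero, one_pow, one_mul]

lemma exists_algebraMap_eq_of_pow_card_eq {K : Type*} [Field K] [Algebra F K] [Fintype F] {y : K}
    (hy : y ^ Fintype.card F = y) : ∃ x : F, algebraMap F K x = y := by
  have hne := FiniteField.X_pow_card_sub_X_ne_zero K (Fintype.one_lt_card (α := F))
  have hroots := Polynomial.roots_map_of_map_ne_zero_of_card_eq_natDegree
    (p := (Polynomial.X ^ Fintype.card F - Polynomial.X : Polynomial F)) (algebraMap F K)
    (by simpa using hne) (by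
      rw [FiniteField.roots_X_pow_card_sub_X,
        FiniteField.X_pow_card_sub_X_natDegree_eq F Fintype.one_lt_card]
      rfl)
  have hmem : y ∈ (Polynomial.map (algebraMap F K)
      (Polynomial.X ^ Fintype.card F - Polynomial.X)).roots := by
    simp only [Polynomial.map_sub, Polynomial.map_pow, Polynomial.map_X]
    rw [Polynomial.mem_roots hne]
    simp [hy]
  rw [← hroots] at hmem
  obtain ⟨x, -, hx⟩ := Multiset.mem_map.mp hmem
  exact ⟨x, hx⟩

lemma isRationalPt_of_frobPt_eq [Fintype F] {P : ProjPlane (AlgebraicClosure F)}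
    (h : FrobPt (Fintype.card F) P = P) : IsRationalPt P := by
  conv_rhs at h => rw [← P.mk_rep]
  rw [FrobPt, Projectivization.mk_eq_mk_iff_mul_eq_mul] at h
  obtain ⟨j, hj⟩ := Function.ne_iff.mp P.rep_nonzero
  rw [Pi.zero_apply] at hj
  have hfix : ∀ i, ∃ x : F, algebraMap F (AlgebraicClosure F) x = P.rep i / P.rep j := fun i =>
    exists_algebraMap_eq_of_pow_card_eq (by
      rw [div_pow, div_eq_div_iff (pow_ne_zero _ hj) hj, h i j, mul_comm])
  choose v hv using hfix
  refine ⟨v, fun h0 => ?_, P.rep j, hj, fun i => by rw [hv, mul_div_cancel₀ _ hj]⟩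
  have hvj := hv j
  rw [h0, div_self hj] at hvj
  simp at hvj

/-- Through every point of the projective plane over a field with `q` elements pass `q + 1`
lines. -/
lemma card_lines_through [Fintype F] (Q : ProjPlane F) :
    Nat.card {L : ProjPlane F // Projectivization.orthogonal Q L} = Fintype.card F + 1 := by
  classical
  have : Fintype (ProjPlane F) := Fintype.ofFinite _
  have hcount := Configuration.ProjectivePlane.lineCount_eq (P := ProjPlane F) (ProjPlane F) Q
  have hpoints := Configuration.ProjectivePlane.card_points (ProjPlane F) (ProjPlane F)
  have hcard := Projectivization.card_of_finrank F (Fin 3 → F) (n := 3) (by simp)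
  rw [Nat.card_eq_fintype_card, hpoints, Nat.card_eq_fintype_card] at hcard
  simp only [Finset.sum_range_succ, Finset.sum_range_zero] at hcard
  refine hcount.trans (congrArg (· + 1) ?_)
  nlinarith

/-- A line with a tangency point carries at most `n - 2` rational points of the curve, and at most
`n - 6` if it is a special tangent. -/
lemma card_rational_points_on_line_le [Fintype F] {f : MvPolynomial (Fin 3) F} {n : ℕ}
    (hn : 1 < n) (hf : f.IsHomogeneous n) (hsmooth : SmoothCurve f) (h2 : (2 : F) ≠ 0)
    (hflex3 : ∀ P : ProjPlane (AlgebraicClosure F), OnCurve f P →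
      ∀ w : Fin 3 → AlgebraicClosure F, (∑ i, aeval P.rep (pderiv i f) * w i = 0) →
        (Polynomial.X : Polynomial (AlgebraicClosure F)) ^ 3 ∣ LinePoly f P.rep w)
    (L : ProjPlane F) {P : ProjPlane (AlgebraicClosure F)} (hP : IsTangentAt f L.rep P)
    {S : Finset (ProjPlane F)}
    (hS : ∀ Q ∈ S, OnCurve f (geometricPoint Q) ∧ OnLine L.rep (geometricPoint Q)) :
    S.card + 2 ≤ n ∧ ((∀ P, IsTangentAt f L.rep P → ¬ IsRationalPt P) → S.card + 6 ≤ n) := by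
  classical
  have hcard : (S.image geometricPoint).card = S.card :=
    Finset.card_image_of_injective _ geometricPoint_injective
  have hunion : ∀ T : Finset (ProjPlane (AlgebraicClosure F)),
      (∀ P ∈ T, IsTangentAt f L.rep P) →
      (S.image geometricPoint ∪ T).card + 2 * T.card ≤ n := by
    intro T hT
    refine card_add_two_mul_card_le hn hf hsmooth h2 hflex3 L.rep_nonzero
      Finset.subset_union_right (fun R hR => ?_) hT
    rcases Finset.mem_union.mp hR with hR | hR
    · obtain ⟨Q, hQ, rfl⟩ := Finset.mem_image.mp hR
      exact hS Q hQ
    · exact ⟨(hT R hR).1, (hT R hR).onLine hf⟩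
  refine ⟨?_, fun hspecial => ?_⟩
  · have h := hunion {P} (by simpa using hP)
    have hle := Finset.card_le_card
      (Finset.subset_union_left (s₁ := S.image geometricPoint) (s₂ := {P}))
    rw [Finset.card_singleton] at h
    lia
  · have hne : P ≠ FrobPt (Fintype.card F) P := fun h =>
      hspecial P hP (isRationalPt_of_frobPt_eq h.symm)
    have hT : ∀ R ∈ ({P, FrobPt (Fintype.card F) P} : Finset _), IsTangentAt f L.rep R := by
      simp only [Finset.mem_insert, Finset.mem_singleton, forall_eq_or_imp, forall_eq]
      exact ⟨hP, hP.frobPt hf⟩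
    have h := hunion _ hT
    have hdisj : Disjoint (S.image geometricPoint) {P, FrobPt (Fintype.card F) P} := by
      rw [Finset.disjoint_right]
      intro R hR hmem
      obtain ⟨Q, -, hQ⟩ := Finset.mem_image.mp hmem
      exact hspecial R (hT R hR) (isRationalPt_iff.mpr ⟨Q, hQ⟩)
    rw [Finset.card_union_of_disjoint hdisj, Finset.card_pair hne, hcard] at h
    lia

/-- In the proof of Theorem 2 for degree-7 non-reflexive curves over `F₉`: if every
tangent line of `C` meets `C` at its tangency point with multiplicity at least 3, and
every `F₉`-line is tangent to `C`, then at least 76 of the 91 `F₉`-lines are special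
tangents, i.e. tangent only at non-rational points. -/
theorem special_tangents_at_least_76
    (F : Type*) [Field F] [Fintype F] [CharP F 3] (hcard : Fintype.card F = 9)
    (f : MvPolynomial (Fin 3) F) (hf0 : f ≠ 0) (hfd : f.IsHomogeneous 7)
    (hsmooth : SmoothCurve f)
    (hflex3 : ∀ P : ProjPlane (AlgebraicClosure F), OnCurve f P →
      ∀ w : Fin 3 → AlgebraicClosure F, (∑ i, aeval P.rep (pderiv i f) * w i = 0) →
        (Polynomial.X : Polynomial (AlgebraicClosure F)) ^ 3 ∣ LinePoly f P.rep w)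
    (htan : ∀ a : Fin 3 → F, a ≠ 0 → ∃ P : ProjPlane (AlgebraicClosure F), IsTangentAt f a P) :
    76 ≤ {L : Projectivization F (Fin 3 → F) |
      (∃ P : ProjPlane (AlgebraicClosure F), IsTangentAt f L.rep P) ∧
      ∀ P : ProjPlane (AlgebraicClosure F), IsTangentAt f L.rep P → ¬ IsRationalPt P}.ncard := by
  classical
  have : Fintype (ProjPlane F) := Fintype.ofFinite _
  have h2 : (2 : F) ≠ 0 := by
    intro h
    have := (CharP.cast_eq_zero_iff F 3 2).mp (by exact_mod_cast h)
    lia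
  let C : Finset (ProjPlane F) := {Q | OnCurve f (geometricPoint Q)}
  let special : Finset (ProjPlane F) :=
    {L | ∀ P : ProjPlane (AlgebraicClosure F), IsTangentAt f L.rep P → ¬ IsRationalPt P}
  have hset : {L : Projectivization F (Fin 3 → F) |
      (∃ P : ProjPlane (AlgebraicClosure F), IsTangentAt f L.rep P) ∧
      ∀ P : ProjPlane (AlgebraicClosure F), IsTangentAt f L.rep P → ¬ IsRationalPt P} =
      (special : Set (ProjPlane F)) := by
    ext L
    simpa [special] using fun _ => htan L.rep L.rep_nonzero
  rw [hset, Set.ncard_coe_finset]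
  have htotal : special.card + specialᶜ.card = 91 := by
    rw [Finset.card_add_card_compl, ← Nat.card_eq_fintype_card,
      Projectivization.card_of_finrank F (Fin 3 → F) (n := 3) (by simp)]
    simp [Finset.sum_range_succ, hcard]
  have hnonspecial : specialᶜ.card ≤ C.card := by
    have hex : ∀ L ∈ specialᶜ, ∃ Q, IsTangentAt f L.rep (geometricPoint Q) := by
      intro L hL
      simp only [special, Finset.mem_compl, Finset.mem_filter_univ] at hL
      push Not at hL
      obtain ⟨P, hP, hrat⟩ := hL
      obtain ⟨Q, rfl⟩ := isRationalPt_iff.mp hrat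
      exact ⟨Q, hP⟩
    choose! Q hQ using hex
    refine Finset.card_le_card_of_injOn Q (fun L hL => ?_) fun L hL M hM h => ?_
    · simpa [C] using (hQ L hL).1
    · exact (hQ L hL).eq (h ▸ hQ M hM)
  have hincidence : 10 * C.card =
      ∑ L : ProjPlane F, (C.filter (Projectivization.orthogonal · L)).card := by
    refine Eq.trans ?_ (Finset.sum_card_bipartiteAbove_eq_sum_card_bipartiteBelow
      (s := C) (t := Finset.univ) Projectivization.orthogonal)
    rw [mul_comm, ← smul_eq_mul, ← Finset.sum_const]
    refine Finset.sum_congr rfl fun Q _ => ?_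
    have h := card_lines_through Q
    rw [hcard, Nat.card_eq_fintype_card, Fintype.card_subtype] at h
    exact h.symm
  have hline : ∀ L : ProjPlane F,
      (C.filter (Projectivization.orthogonal · L)).card ≤ 1 + if L ∈ specialᶜ then 4 else 0 := by
    intro L
    obtain ⟨P, hP⟩ := htan L.rep L.rep_nonzero
    obtain ⟨h5, h6⟩ := card_rational_points_on_line_le (by norm_num) hfd hsmooth h2 hflex3 L hP
      (S := C.filter (Projectivization.orthogonal · L)) fun Q hQ => by
        rw [onLine_geometricPoint_iff]
        simpa [C] using hQ
    split_ifs with hL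
    · lia
    · have := h6 (by simpa [special] using hL)
      lia
  have hsum := Finset.sum_le_sum fun L (_ : L ∈ Finset.univ) => hline L
  rw [← hincidence, Finset.sum_add_distrib, Finset.sum_ite_mem, Finset.univ_inter] at hsum
  simp only [Finset.sum_const, smul_eq_mul, mul_one, Finset.card_univ] at hsum
  rw [← Finset.card_add_card_compl special] at hsum
  lia

end
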